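/- arXiv:2202.02897 — 3 statements merged into one kernel-verified Lean document; each statement's English description precedes it below -/
import Mathlib

section
/- Let n ≥ 1 and let w ∈ S_n be a permutation such that 𝔖_w is multiplicity-free. Then for every b ∈ ℕ^n, there exists a ∈ supp(𝔖_w) with a ≤ b componentwise if and only if there exists a ∈ supp(𝔊_w) with a ≤ b componentwise. -/
open scoped Classical
open MvPolynomial

noncomputable section

/-- `S` is the family of Schubert polynomials for `S_n` (indexing variables by `Fin n`,
so the vector `(a_1, …, a_n)` corresponds to `a : Fin n →₀ ℕ`): the polynomial of the
longest element `w₀` (given by `Fin.revPerm`) is `x_1^{n-1} x_2^{n-2} ⋯ x_{n-1}`, and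
whenever `w i > w (i+1)` we have `S (w * s_i) = ∂_i (S w)`, i.e.
`(x_i - x_{i+1}) * S (w * s_i) = S w - s_i (S w)`. -/
def IsSchubertFamily {n : ℕ} (S : Equiv.Perm (Fin n) → MvPolynomial (Fin n) ℤ) : Prop :=
  S Fin.revPerm = ∏ i : Fin n, X i ^ (Fin.rev i : ℕ) ∧
    ∀ (w : Equiv.Perm (Fin n)) (i j : Fin n), (j : ℕ) = (i : ℕ) + 1 → w j < w i →
      (X i - X j) * S (w * Equiv.swap i j) = S w - rename (Equiv.swap i j) (S w)

/-- `G` is the family of Grothendieck polynomials for `S_n`: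
`G w₀ = x_1^{n-1} x_2^{n-2} ⋯ x_{n-1}`, and whenever `w i > w (i+1)` we have
`G (w * s_i) = π_i (G w)` where `π_i f = ∂_i ((1 - x_{i+1}) f)`, i.e.
`(x_i - x_{i+1}) * G (w * s_i) = (1 - x_{i+1}) * G w - s_i ((1 - x_{i+1}) * G w)`. -/
def IsGrothendieckFamily {n : ℕ} (G : Equiv.Perm (Fin n) → MvPolynomial (Fin n) ℤ) : Prop :=
  G Fin.revPerm = ∏ i : Fin n, X i ^ (Fin.rev i : ℕ) ∧
    ∀ (w : Equiv.Perm (Fin n)) (i j : Fin n), (j : ℕ) = (i : ℕ) + 1 → w j < w i →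
      (X i - X j) * G (w * Equiv.swap i j) =
        (1 - X j) * G w - rename (Equiv.swap i j) ((1 - X j) * G w)

section HeckeFactorization

variable {R E : Type*} [CommRing R] [Ring E] [Algebra R E]

/-- The product `(1 + x u_i) (1 + x u_{i+1}) ⋯ (1 + x u_{i+m-1})`. -/
def ladder (u : ℕ → E) (x : R) : ℕ → ℕ → E
  | _, 0 => 1
  | i, m + 1 => (1 + x • u i) * ladder u x (i + 1) m

/-- The product `A_{k-1}(x_{k-1}) ⋯ A_0(x_0)`, where `A_i(x) = (1 + x u_i) ⋯ (1 + x u_{N-1})`. -/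
def staircase (u : ℕ → E) (N : ℕ) (x : ℕ → R) : ℕ → E
  | 0 => 1
  | k + 1 => ladder u (x k) k (N - k) * staircase u N x k

/-- The relations of the Hecke algebra with quadratic relation `u_j ^ 2 = β u_j`. -/
structure HeckeRelations (β : R) (u : ℕ → E) : Prop where
  quad : ∀ j, u j * u j = β • u j
  braid : ∀ j, u j * u (j + 1) * u j = u (j + 1) * u j * u (j + 1)
  comm : ∀ i j, i + 2 ≤ j → Commute (u i) (u j)

theorem commute_ladder {β : R} {u : ℕ → E} (hu : HeckeRelations β u) (x : R) {i : ℕ} (m : ℕ) :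
    ∀ {j : ℕ}, i + 2 ≤ j → Commute (u i) (ladder u x j m) := by
  induction m with
  | zero => intro j _; exact Commute.one_right _
  | succ m ih =>
    intro j hj
    exact ((Commute.one_right _).add_right ((hu.comm i j hj).smul_right x)).mul_right
      (ih (by omega))

theorem yang_baxter {β : R} {u : ℕ → E} (hu : HeckeRelations β u) (j : ℕ) (x y : R) :
    (1 + x • u j) * (1 + x • u (j + 1)) * (1 + y • u j) *
        ((1 + β * x) • (1 : E) + (y - x) • u (j + 1)) =
      (1 + β * x) • ((1 + y • u j) * (1 + y • u (j + 1)) * (1 + x • u j)) := by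
  have h1 : u j * (u (j + 1) * u j) = u (j + 1) * (u j * u (j + 1)) := by
    simpa only [mul_assoc] using hu.braid j
  simp only [mul_add, add_mul, mul_one, one_mul, smul_mul_assoc, mul_smul_comm, mul_assoc,
    hu.quad, h1]
  module

theorem ladder_exchange_of_commute {β : R} {u : ℕ → E} (hu : HeckeRelations β u) {x y : R}
    {i m : ℕ} (h : Commute (ladder u x i (m + 1)) (ladder u y i (m + 1))) :
    ((1 + β * x) • (1 : E) + (y - x) • u i) *
        (ladder u y (i + 1) m * ladder u x i (m + 1)) =
      (1 + β * x) • (ladder u x (i + 1) m * ladder u y i (m + 1)) := by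
  have hk : (1 + β * x) • (1 : E) + (y - x) • u i =
      ((1 + β * x) • (1 : E) - x • u i) * (1 + y • u i) := by
    simp only [mul_add, sub_mul, mul_one, one_mul, smul_mul_assoc, mul_smul_comm, hu.quad]
    module
  have hx : ((1 + β * x) • (1 : E) - x • u i) * (1 + x • u i) = (1 + β * x) • (1 : E) := by
    simp only [mul_add, sub_mul, mul_one, one_mul, smul_mul_assoc, mul_smul_comm, hu.quad]
    module
  rw [hk, mul_assoc, ← mul_assoc (1 + y • u i)]
  change _ * (ladder u y i (m + 1) * ladder u x i (m + 1)) = _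
  rw [← h.eq]
  change _ * ((1 + x • u i) * ladder u x (i + 1) m * ladder u y i (m + 1)) = _
  rw [← mul_assoc, ← mul_assoc, hx, smul_mul_assoc, one_mul, smul_mul_assoc]

theorem commute_ladder_ladder {β : R} {u : ℕ → E} (hu : HeckeRelations β u) {x y : R}
    (hx : IsSMulRegular E (1 + β * x)) (m : ℕ) :
    ∀ i, Commute (ladder u x i m) (ladder u y i m) := by
  induction m with
  | zero => intro i; exact Commute.one_right _
  | succ m ih =>
    intro i
    cases m with
    | zero =>
      simp only [ladder, mul_one]
      exact (Commute.one_left _).add_left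
        ((Commute.one_right _).add_right
          (((Commute.refl (u i)).smul_left x).smul_right y))
    | succ m =>
      have hcomm : ∀ a b : R, ladder u a (i + 2) m * (1 + b • u i) =
          (1 + b • u i) * ladder u a (i + 2) m := fun a b =>
        ((Commute.one_right _).add_right
          ((commute_ladder hu a m le_rfl).symm.smul_right b)).eq
      have hexp : ∀ a b : R, ladder u a i (m + 2) * ladder u b i (m + 2) =
          (1 + a • u i) * (1 + a • u (i + 1)) * (1 + b • u i) *
            (ladder u a (i + 2) m * ladder u b (i + 1) (m + 1)) := fun a b => by
        change (1 + a • u i) * ((1 + a • u (i + 1)) * ladder u a (i + 2) m) *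
          ((1 + b • u i) * ladder u b (i + 1) (m + 1)) = _
        simp only [mul_assoc]
        rw [← mul_assoc (ladder u a (i + 2) m), hcomm, mul_assoc]
      apply hx
      change (1 + β * x) • (ladder u x i (m + 2) * ladder u y i (m + 2)) =
        (1 + β * x) • (ladder u y i (m + 2) * ladder u x i (m + 2))
      rw [hexp x y, hexp y x, ← mul_smul_comm, ← ladder_exchange_of_commute hu (ih (i + 1)),
        ← mul_assoc, yang_baxter hu, smul_mul_assoc]

theorem staircase_congr (u : ℕ → E) (N : ℕ) {x y : ℕ → R} (k : ℕ) (h : ∀ i < k, x i = y i) :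
    staircase u N x k = staircase u N y k := by
  induction k with
  | zero => rfl
  | succ k ih =>
    simp only [staircase, h k (by omega), ih fun i hi => h i (by omega)]

/-- Exchanging the variables `x_i` and `x_{i+1}` in a staircase product. -/
theorem staircase_swap {β : R} {u : ℕ → E} (hu : HeckeRelations β u) {N : ℕ} {x : ℕ → R} {i : ℕ}
    (hx : IsSMulRegular E (1 + β * x i)) (hi : i + 1 ≤ N) {k : ℕ} (hk : i + 2 ≤ k) :
    ((1 + β * x i) • (1 : E) + (x (i + 1) - x i) • u i) * staircase u N x k =
      (1 + β * x i) • staircase u N (x ∘ Equiv.swap i (i + 1)) k := by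
  induction k, hk using Nat.le_induction with
  | base =>
    obtain ⟨m, hm⟩ : ∃ m, N - i = m + 1 := ⟨N - i - 1, by omega⟩
    have hm' : N - (i + 1) = m := by omega
    have hc : staircase u N (x ∘ Equiv.swap i (i + 1)) i = staircase u N x i :=
      staircase_congr u N i fun j hj => by
        simp [Equiv.swap_apply_of_ne_of_ne (show j ≠ i by omega) (show j ≠ i + 1 by omega)]
    simp only [staircase, hm, hm', hc, Function.comp, Equiv.swap_apply_left,
      Equiv.swap_apply_right]
    rw [← mul_assoc (ladder u (x (i + 1)) (i + 1) m), ← mul_assoc,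
      ladder_exchange_of_commute hu (commute_ladder_ladder hu hx _ _), smul_mul_assoc, mul_assoc]
  | succ k hk ih =>
    have hc : Commute ((1 + β * x i) • (1 : E) + (x (i + 1) - x i) • u i)
        (ladder u (x k) k (N - k)) :=
      ((Commute.one_left _).smul_left _).add_left ((commute_ladder hu _ _ hk).smul_left _)
    simp only [staircase, Function.comp,
      Equiv.swap_apply_of_ne_of_ne (show k ≠ i by omega) (show k ≠ i + 1 by omega)]
    rw [← mul_assoc, hc.eq, mul_assoc, ih, mul_smul_comm]

end HeckeFactorization

section DescentOperators

variable {n : ℕ} {R : Type*} [CommRing R]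

/-- Right multiplication by the `j`-th generator of the Hecke algebra with parameter `β`, acting
on functions on `S_n`; it is zero if `j + 1 ≥ n`. -/
def descentOp (n : ℕ) (β : R) (j : ℕ) : Module.End R (Equiv.Perm (Fin n) → R) where
  toFun F w :=
    if h : j + 1 < n then
      if w ⟨j + 1, h⟩ < w ⟨j, by omega⟩ then
        F (w * Equiv.swap ⟨j, Nat.lt_of_succ_lt h⟩ ⟨j + 1, h⟩) + β * F w
      else 0
    else 0
  map_add' F H := by
    funext w
    simp only [Pi.add_apply]
    split_ifs <;> ring
  map_smul' c F := by
    funext w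
    simp only [Pi.smul_apply, smul_eq_mul, RingHom.id_apply]
    split_ifs <;> ring

theorem descentOp_apply (β : R) (j : ℕ) (F : Equiv.Perm (Fin n) → R) (w : Equiv.Perm (Fin n)) :
    descentOp n β j F w = if h : j + 1 < n then
      if w ⟨j + 1, h⟩ < w ⟨j, by omega⟩ then
        F (w * Equiv.swap ⟨j, by omega⟩ ⟨j + 1, h⟩) + β * F w
      else 0
    else 0 := rfl

theorem descentOp_of_lt (β : R) {i j : Fin n} (hij : (j : ℕ) = i + 1)
    (F : Equiv.Perm (Fin n) → R) {w : Equiv.Perm (Fin n)} (h : w j < w i) :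
    descentOp n β i F w = F (w * Equiv.swap i j) + β * F w := by
  obtain ⟨i, hi⟩ := i
  obtain ⟨j, hj⟩ := j
  obtain rfl : j = i + 1 := hij
  rw [descentOp_apply, dif_pos hj, if_pos h]

theorem descentOp_of_not_lt (β : R) {i j : Fin n} (hij : (j : ℕ) = i + 1)
    (F : Equiv.Perm (Fin n) → R) {w : Equiv.Perm (Fin n)} (h : ¬ w j < w i) :
    descentOp n β i F w = 0 := by
  obtain ⟨i, hi⟩ := i
  obtain ⟨j, hj⟩ := j
  obtain rfl : j = i + 1 := hij
  rw [descentOp_apply, dif_pos hj, if_neg h]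

theorem descentOp_eq_zero (β : R) {j : ℕ} (h : ¬ j + 1 < n) : descentOp n β j = 0 := by
  ext F w
  simp [descentOp_apply, h]

theorem hecke_descentOp (β : R) : HeckeRelations β (descentOp n β) where
  quad j := by
    by_cases h : j + 1 < n
    · refine LinearMap.ext fun F => funext fun w => ?_
      obtain ⟨a, ha⟩ : ∃ a : Fin n, (a : ℕ) = j := ⟨⟨j, by omega⟩, rfl⟩
      obtain ⟨b, hb⟩ : ∃ b : Fin n, (b : ℕ) = a + 1 := ⟨⟨j + 1, h⟩, by simp [ha]⟩
      subst ha
      by_cases hw : w b < w a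
      · have : ¬ (w * Equiv.swap a b) b < (w * Equiv.swap a b) a := by simpa using hw.le
        simp [descentOp_of_lt β hb _ hw, descentOp_of_not_lt β hb _ this]
      · simp [descentOp_of_not_lt β hb _ hw]
    · simp [descentOp_eq_zero β h]
  braid j := by
    by_cases h : j + 1 + 1 < n
    · refine LinearMap.ext fun F => funext fun w => ?_
      obtain ⟨a, ha⟩ : ∃ a : Fin n, (a : ℕ) = j := ⟨⟨j, by omega⟩, rfl⟩
      obtain ⟨b, hb⟩ : ∃ b : Fin n, (b : ℕ) = a + 1 := ⟨⟨j + 1, by omega⟩, by simp [ha]⟩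
      obtain ⟨c, hc⟩ : ∃ c : Fin n, (c : ℕ) = b + 1 := ⟨⟨j + 2, h⟩, by simp [hb, ha]⟩
      subst ha
      rw [← hb]
      have hab : a ≠ b := by omega
      have hbc : b ≠ c := by omega
      have hac : a ≠ c := by omega
      have ev1 : ∀ G v, descentOp n β a G v =
          if v b < v a then G (v * Equiv.swap a b) + β * G v else 0 := fun G v => by
        split_ifs with hv
        exacts [descentOp_of_lt β hb G hv, descentOp_of_not_lt β hb G hv]
      have ev2 : ∀ G v, descentOp n β b G v =
          if v c < v b then G (v * Equiv.swap b c) + β * G v else 0 := fun G v => by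
        split_ifs with hv
        exacts [descentOp_of_lt β hc G hv, descentOp_of_not_lt β hc G hv]
      have hbr : w * Equiv.swap a b * Equiv.swap b c * Equiv.swap a b =
          w * Equiv.swap b c * Equiv.swap a b * Equiv.swap b c := by
        simp only [mul_assoc]
        congr 1
        have e1 := Equiv.swap_mul_swap_mul_swap (x := c) (y := b) (z := a) hbc.symm hac.symm
        have e2 := Equiv.swap_mul_swap_mul_swap (x := a) (y := b) (z := c) hab hac
        rw [Equiv.swap_comm b a, Equiv.swap_comm c b] at e1
        rw [← mul_assoc, ← mul_assoc, e1, e2, Equiv.swap_comm]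
      have h1 : w a ≠ w b := fun e => hab (w.injective e)
      have h2 : w b ≠ w c := fun e => hbc (w.injective e)
      have h3 : w a ≠ w c := fun e => hac (w.injective e)
      simp only [Module.End.mul_apply, ev1, ev2, Equiv.Perm.mul_apply, Equiv.swap_apply_left,
        Equiv.swap_apply_right, Equiv.swap_apply_of_ne_of_ne hac.symm hbc.symm,
        Equiv.swap_apply_of_ne_of_ne hab hac, hbr, mul_assoc w (Equiv.swap a b) (Equiv.swap a b),
        mul_assoc w (Equiv.swap b c) (Equiv.swap b c), Equiv.swap_mul_self, mul_one]
      split_ifs <;> first | omega | ring1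
    · simp [descentOp_eq_zero β h]
  comm i j hij := by
    by_cases h : j + 1 < n
    · refine LinearMap.ext fun F => funext fun w => ?_
      obtain ⟨a, ha⟩ : ∃ a : Fin n, (a : ℕ) = i := ⟨⟨i, by omega⟩, rfl⟩
      obtain ⟨b, hb⟩ : ∃ b : Fin n, (b : ℕ) = a + 1 := ⟨⟨i + 1, by omega⟩, by simp [ha]⟩
      obtain ⟨c, hc⟩ : ∃ c : Fin n, (c : ℕ) = j := ⟨⟨j, by omega⟩, rfl⟩
      obtain ⟨d, hd⟩ : ∃ d : Fin n, (d : ℕ) = c + 1 := ⟨⟨j + 1, h⟩, by simp [hc]⟩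
      subst ha
      subst hc
      have hac : a ≠ c := by omega
      have had : a ≠ d := by omega
      have hbc : b ≠ c := by omega
      have hbd : b ≠ d := by omega
      have ev1 : ∀ G v, descentOp n β a G v =
          if v b < v a then G (v * Equiv.swap a b) + β * G v else 0 := fun G v => by
        split_ifs with hv
        exacts [descentOp_of_lt β hb G hv, descentOp_of_not_lt β hb G hv]
      have ev2 : ∀ G v, descentOp n β c G v =
          if v d < v c then G (v * Equiv.swap c d) + β * G v else 0 := fun G v => by
        split_ifs with hv
        exacts [descentOp_of_lt β hd G hv, descentOp_of_not_lt β hd G hv]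
      have hcm : w * Equiv.swap c d * Equiv.swap a b = w * Equiv.swap a b * Equiv.swap c d := by
        rw [mul_assoc, mul_assoc, Equiv.Perm.Disjoint.commute (f := Equiv.swap c d)]
        intro t
        by_cases h1 : t = a
        · subst h1
          exact Or.inl (Equiv.swap_apply_of_ne_of_ne hac had)
        · by_cases h2 : t = b
          · subst h2
            exact Or.inl (Equiv.swap_apply_of_ne_of_ne hbc hbd)
          · exact Or.inr (Equiv.swap_apply_of_ne_of_ne h1 h2)
      simp only [Module.End.mul_apply, ev1, ev2, Equiv.Perm.mul_apply,
        Equiv.swap_apply_of_ne_of_ne hac had, Equiv.swap_apply_of_ne_of_ne hbc hbd,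
        Equiv.swap_apply_of_ne_of_ne hac.symm hbc.symm,
        Equiv.swap_apply_of_ne_of_ne had.symm hbd.symm, hcm]
      split_ifs <;> ring
    · simp [descentOp_eq_zero β h]

end DescentOperators

section Inversions

variable {n : ℕ}

/-- The inversions of a permutation. -/
def inversions (w : Equiv.Perm (Fin n)) : Finset (Fin n × Fin n) :=
  Finset.univ.filter fun p => p.1 < p.2 ∧ w p.2 < w p.1

theorem mem_inversions {w : Equiv.Perm (Fin n)} {a b : Fin n} :
    (a, b) ∈ inversions w ↔ a < b ∧ w b < w a := by
  simp [inversions]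

theorem card_inversions_mul_swap {i j : Fin n} (hij : (j : ℕ) = i + 1) {w : Equiv.Perm (Fin n)}
    (h : w j < w i) :
    (inversions (w * Equiv.swap i j)).card + 1 = (inversions w).card := by
  have hmem : (i, j) ∈ inversions w := mem_inversions.2 ⟨by omega, h⟩
  have hmap : (inversions (w * Equiv.swap i j)).map
      ((Equiv.swap i j).prodCongr (Equiv.swap i j)).toEmbedding = (inversions w).erase (i, j) := by
    ext ⟨a, b⟩
    rw [Finset.mem_map_equiv]
    simp only [Equiv.prodCongr_symm, Equiv.symm_swap, Equiv.prodCongr_apply, Prod.map,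
      mem_inversions, Finset.mem_erase, Equiv.Perm.mul_apply, Equiv.swap_apply_self,
      ne_eq, Prod.mk.injEq]
    by_cases hab : a = b
    · subst hab
      simp
    by_cases hji : a = j ∧ b = i
    · obtain ⟨rfl, rfl⟩ := hji
      simp [h.not_gt]
    have key : Equiv.swap i j a < Equiv.swap i j b ↔ ¬ (a = i ∧ b = j) ∧ a < b := by
      simp only [Equiv.swap_apply_def]
      split_ifs <;> omega
    rw [key]
    tauto
  rw [← Finset.card_map ((Equiv.swap i j).prodCongr (Equiv.swap i j)).toEmbedding, hmap,
    Finset.card_erase_add_one hmem]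

theorem eq_revPerm_of_forall_descent {w : Equiv.Perm (Fin n)}
    (h : ∀ i j : Fin n, (j : ℕ) = i + 1 → w j < w i) : w = Fin.revPerm := by
  cases n with
  | zero => exact Subsingleton.elim _ _
  | succ n =>
    have hmono : StrictMono (fun i => Fin.rev (w i)) := by
      rw [Fin.strictMono_iff_lt_succ]
      intro i
      exact Fin.rev_lt_rev.2 (h _ _ (by simp))
    have := hmono.range_inj (g := id) strictMono_id |>.1 (by
      rw [Set.range_id, Set.range_eq_univ]
      exact Fin.rev_surjective.comp w.surjective)
    ext1 i
    have h2 := congrFun this i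
    simp only [id] at h2
    rw [Fin.revPerm_apply, ← h2, Fin.rev_rev, h2]

/-- Induction on permutations, going down in weak order from the longest one. -/
theorem descent_induction {P : Equiv.Perm (Fin n) → Prop} (hrev : P Fin.revPerm)
    (hstep : ∀ (w : Equiv.Perm (Fin n)) (i j : Fin n), (j : ℕ) = i + 1 → w j < w i →
      P w → P (w * Equiv.swap i j)) (w : Equiv.Perm (Fin n)) : P w := by
  induction hk : Fintype.card (Fin n × Fin n) - (inversions w).card using Nat.strong_induction_on
    generalizing w with
  | _ k ih =>
    by_cases h : ∀ i j : Fin n, (j : ℕ) = i + 1 → w j < w i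
    · exact eq_revPerm_of_forall_descent h ▸ hrev
    · push Not at h
      obtain ⟨i, j, hij, hw⟩ := h
      have hne : w i ≠ w j := fun e => by
        have := w.injective e
        omega
      have hd : (w * Equiv.swap i j) j < (w * Equiv.swap i j) i := by
        simpa using lt_of_le_of_ne hw hne
      have hinv := card_inversions_mul_swap hij hd
      rw [mul_assoc, Equiv.swap_mul_self, mul_one] at hinv
      have hle := Finset.card_le_univ (inversions (w * Equiv.swap i j))
      have := hstep _ i j hij hd (ih _ (by omega) _ rfl)
      rwa [mul_assoc, Equiv.swap_mul_self, mul_one] at this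

end Inversions

section HeckeSeries

variable {n : ℕ} {R : Type*} [CommRing R]

/-- The coefficients of the staircase product, as a function on `S_n`. -/
def heckeCoeff (n : ℕ) (β : R) (x : ℕ → R) : Equiv.Perm (Fin n) → R :=
  staircase (descentOp n β) (n - 1) x n (Pi.single 1 1)

theorem map_ladder (φ : R →+* R) {β : R} (hβ : φ β = β) (x : R) (m : ℕ) :
    ∀ (i : ℕ) (F : Equiv.Perm (Fin n) → R), φ ∘ ladder (descentOp n β) x i m F =
      ladder (descentOp n β) (φ x) i m (φ ∘ F) := by
  induction m with
  | zero => intro i F; rfl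
  | succ m ih =>
    intro i F
    funext w
    simp only [ladder, Module.End.mul_apply, LinearMap.add_apply, Module.End.one_apply,
      LinearMap.smul_apply, ← ih, Function.comp_apply, Pi.add_apply, Pi.smul_apply, smul_eq_mul,
      map_add, map_mul, descentOp_apply]
    split_ifs <;> simp [hβ]

theorem map_staircase (φ : R →+* R) {β : R} (hβ : φ β = β) (x : ℕ → R) (N k : ℕ)
    (F : Equiv.Perm (Fin n) → R) : φ ∘ staircase (descentOp n β) N x k F =
      staircase (descentOp n β) N (φ ∘ x) k (φ ∘ F) := by
  induction k with
  | zero => rfl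
  | succ k ih =>
    simp only [staircase, Module.End.mul_apply, map_ladder φ hβ, ih, Function.comp_apply]

theorem heckeCoeff_mul_swap [IsDomain R] (φ : R →+* R) {β : R} (hβ : φ β = β) (x : ℕ → R)
    {i j : Fin n} (hij : (j : ℕ) = i + 1) (hx : φ ∘ x = x ∘ Equiv.swap (i : ℕ) (i + 1))
    (hne : 1 + β * x i ≠ 0) {w : Equiv.Perm (Fin n)} (hw : w j < w i) :
    (x i - x j) * heckeCoeff n β x (w * Equiv.swap i j) =
      (1 + β * x j) * heckeCoeff n β x w - φ ((1 + β * x j) * heckeCoeff n β x w) := by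
  have hreg : IsSMulRegular (Module.End R (Equiv.Perm (Fin n) → R)) (1 + β * x i) := by
    intro f g hfg
    refine LinearMap.ext fun F => funext fun v => ?_
    have := congrFun (LinearMap.congr_fun hfg F) v
    exact mul_left_cancel₀ hne this
  have key := congrFun (LinearMap.congr_fun (staircase_swap (hecke_descentOp (n := n) β)
    (N := n - 1) hreg (by omega) (show (i : ℕ) + 2 ≤ n by omega)) (Pi.single 1 1)) w
  have hs : φ ∘ (Pi.single 1 1 : Equiv.Perm (Fin n) → R) = Pi.single 1 1 := by
    funext v
    simp only [Function.comp_apply, Pi.single_apply]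
    split_ifs <;> simp
  have hφ : φ (heckeCoeff n β x w) =
      staircase (descentOp n β) (n - 1) (x ∘ Equiv.swap (i : ℕ) (i + 1)) n (Pi.single 1 1) w := by
    have := congrFun (map_staircase φ hβ x (n - 1) n (Pi.single 1 1)) w
    rwa [hs, hx] at this
  have hφx : φ (x j) = x i := by
    have := congrFun hx j
    simpa [hij] using this
  rw [← hij] at hφ
  simp only [Module.End.mul_apply, LinearMap.add_apply, Module.End.one_apply,
    LinearMap.smul_apply, Pi.add_apply, Pi.smul_apply, smul_eq_mul, ← hij, ← hφ,
    descentOp_of_lt β hij _ hw] at key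
  change (1 + β * x i) * heckeCoeff n β x w + (x j - x i) *
    (heckeCoeff n β x (w * Equiv.swap i j) + β * heckeCoeff n β x w) = _ at key
  simp only [map_add, map_mul, map_one, hβ, hφx]
  linear_combination -key

/-- The function `F` vanishes on permutations with more inversions than `p`, and on permutations
with as many inversions as `p` it is supported at `p`, where its value is `c`. -/
def IsTopAt (F : Equiv.Perm (Fin n) → R) (p : Equiv.Perm (Fin n)) (c : R) : Prop :=
  ∀ w, (inversions p).card ≤ (inversions w).card → F w = if w = p then c else 0

theorem IsTopAt.step {F : Equiv.Perm (Fin n) → R} {p : Equiv.Perm (Fin n)} {c : R}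
    (h : IsTopAt F p c) (β x : R) {i j : Fin n} (hij : (j : ℕ) = i + 1) (hp : p i < p j) :
    IsTopAt ((1 + x • descentOp n β i) F) (p * Equiv.swap i j) (x * c) := by
  have hd : (p * Equiv.swap i j) j < (p * Equiv.swap i j) i := by simpa using hp
  have hinv := card_inversions_mul_swap hij hd
  rw [mul_assoc, Equiv.swap_mul_self, mul_one] at hinv
  intro w hw
  have hF : F w = 0 := by
    rw [h w (by omega), if_neg]
    rintro rfl
    omega
  simp only [LinearMap.add_apply, Module.End.one_apply, LinearMap.smul_apply, Pi.add_apply,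
    Pi.smul_apply, smul_eq_mul, hF, zero_add]
  by_cases hwd : w j < w i
  · have hinv' := card_inversions_mul_swap hij hwd
    rw [descentOp_of_lt β hij F hwd, hF, h _ (by omega)]
    have : w * Equiv.swap i j = p ↔ w = p * Equiv.swap i j := by
      rw [← Equiv.swap_inv i j, eq_mul_inv_iff_mul_eq, Equiv.swap_inv]
    simp [this]
  · rw [descentOp_of_not_lt β hij F hwd, if_neg, mul_zero]
    rintro rfl
    exact hwd hd

theorem exists_isTopAt_ladder (β x : R) {F : Equiv.Perm (Fin n) → R} {p : Equiv.Perm (Fin n)}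
    {c : R} (h : IsTopAt F p c) {k : ℕ}
    (hp : ∀ t : Fin n, (p t : ℕ) = if (t : ℕ) < k then n - 1 - t else t - k) (m : ℕ) :
    ∀ i, k ≤ i → i + m = n - 1 → ∃ q : Equiv.Perm (Fin n),
      (∀ t : Fin n, (q t : ℕ) = if (t : ℕ) < k then n - 1 - t else if (t : ℕ) < i then t - k
        else if (t : ℕ) = i then n - 1 - k else t - k - 1) ∧
      IsTopAt (ladder (descentOp n β) x i m F) q (x ^ m * c) := by
  induction m with
  | zero =>
    intro i hi him
    refine ⟨p, fun t => ?_, by simpa [ladder] using h⟩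
    rw [hp t]
    split_ifs <;> omega
  | succ m ih =>
    intro i hi him
    obtain ⟨q, hq, hF⟩ := ih (i + 1) (by omega) (by omega)
    obtain ⟨a, ha⟩ : ∃ a : Fin n, (a : ℕ) = i := ⟨⟨i, by omega⟩, rfl⟩
    obtain ⟨b, hb⟩ : ∃ b : Fin n, (b : ℕ) = a + 1 := ⟨⟨i + 1, by omega⟩, by simp [ha]⟩
    subst ha
    have hqa := hq a
    have hqb := hq b
    have hlt : q a < q b := by
      rw [Fin.lt_def, hqa, hqb]
      split_ifs <;> omega
    refine ⟨q * Equiv.swap a b, fun t => ?_, ?_⟩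
    · rw [Equiv.Perm.mul_apply, Equiv.swap_apply_def]
      split_ifs with h1 h2 <;> simp only [hq] <;> split_ifs <;> omega
    · have := hF.step β x hb hlt
      rwa [← mul_assoc, ← pow_succ'] at this

theorem exists_isTopAt_staircase (β : R) (x : ℕ → R) (k : ℕ) (hk : k ≤ n) :
    ∃ p : Equiv.Perm (Fin n),
      (∀ t : Fin n, (p t : ℕ) = if (t : ℕ) < k then n - 1 - t else t - k) ∧
      IsTopAt (staircase (descentOp n β) (n - 1) x k (Pi.single 1 1)) p
        (∏ i ∈ Finset.range k, x i ^ (n - 1 - i)) := by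
  induction k with
  | zero =>
    refine ⟨1, fun t => by simp, fun w _ => ?_⟩
    simp [staircase, Pi.single_apply]
  | succ k ih =>
    obtain ⟨p, hp, hF⟩ := ih (by omega)
    obtain ⟨q, hq, hF'⟩ := exists_isTopAt_ladder β (x k) hF hp (n - 1 - k) k le_rfl (by omega)
    refine ⟨q, fun t => ?_, ?_⟩
    · rw [hq t]
      split_ifs <;> omega
    · rw [Finset.prod_range_succ, mul_comm]
      exact hF'

theorem heckeCoeff_revPerm (β : R) (x : ℕ → R) :
    heckeCoeff n β x Fin.revPerm = ∏ i : Fin n, x i ^ (Fin.rev i : ℕ) := by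
  obtain ⟨p, hp, hF⟩ := exists_isTopAt_staircase (n := n) β x n le_rfl
  have hrev : p = Fin.revPerm := by
    ext t
    rw [hp t, if_pos t.isLt, Fin.revPerm_apply, Fin.val_rev]
    omega
  subst hrev
  have := hF Fin.revPerm le_rfl
  rw [if_pos rfl] at this
  rw [heckeCoeff, this, Finset.prod_range]
  refine Finset.prod_congr rfl fun i _ => ?_
  rw [Fin.val_rev]
  congr 1
  omega

end HeckeSeries

section Supports

variable {n : ℕ}

/-- A factor `1 + x u_i` of the staircase product. -/
abbrev heckeFactor (β x : MvPolynomial (Fin n) ℤ) (i : ℕ) :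
    Module.End (MvPolynomial (Fin n) ℤ) (Equiv.Perm (Fin n) → MvPolynomial (Fin n) ℤ) :=
  1 + x • descentOp n β i

/-- The variables of `ℤ[x_0, …, x_{n-1}]`, extended by zero. -/
def variableSeq (n : ℕ) (k : ℕ) : MvPolynomial (Fin n) ℤ :=
  if h : k < n then X ⟨k, h⟩ else 0

theorem variableSeq_val (i : Fin n) : variableSeq n i = X i := by
  simp [variableSeq]

theorem rename_variableSeq {i j : Fin n} (hij : (j : ℕ) = i + 1) :
    (rename (Equiv.swap i j) : MvPolynomial (Fin n) ℤ →ₐ[ℤ] _).toRingHom ∘ variableSeq n =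
      variableSeq n ∘ Equiv.swap (i : ℕ) (i + 1) := by
  funext k
  by_cases hk : k < n
  · obtain ⟨k, rfl⟩ : ∃ t : Fin n, (t : ℕ) = k := ⟨⟨k, hk⟩, rfl⟩
    have : Equiv.swap (i : ℕ) (i + 1) k = (Equiv.swap i j k : Fin n) := by
      rw [← hij]
      simp only [Equiv.swap_apply_def, Fin.val_inj]
      split_ifs <;> rfl
    simp only [Function.comp_apply, this, variableSeq_val]
    simp
  · have : Equiv.swap (i : ℕ) (i + 1) k = k :=
      Equiv.swap_apply_of_ne_of_ne (by omega) (by omega)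
    simp [this, variableSeq, hk]

/-- A family satisfying the `β`-deformed recursion consists of coefficients of the
staircase product. -/
theorem eq_heckeCoeff {β : ℤ} {G : Equiv.Perm (Fin n) → MvPolynomial (Fin n) ℤ}
    (hrev : G Fin.revPerm = ∏ i : Fin n, X i ^ (Fin.rev i : ℕ))
    (hG : ∀ (w : Equiv.Perm (Fin n)) (i j : Fin n), (j : ℕ) = (i : ℕ) + 1 → w j < w i →
      (X i - X j) * G (w * Equiv.swap i j) =
        (1 + C β * X j) * G w - rename (Equiv.swap i j) ((1 + C β * X j) * G w))
    (w : Equiv.Perm (Fin n)) : G w = heckeCoeff n (C β) (variableSeq n) w := by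
  induction w using descent_induction with
  | hrev => simp only [hrev, heckeCoeff_revPerm, variableSeq_val]
  | hstep w i j hij hw ih =>
    have hne : (1 + C β * variableSeq n i : MvPolynomial (Fin n) ℤ) ≠ 0 := fun e => by
      have := congrArg constantCoeff e
      simp [variableSeq_val] at this
    have h := heckeCoeff_mul_swap
      (rename (Equiv.swap i j) : MvPolynomial (Fin n) ℤ →ₐ[ℤ] _).toRingHom (by simp) (variableSeq n) hij
      (rename_variableSeq hij) hne hw
    have hij' : (X i - X j : MvPolynomial (Fin n) ℤ) ≠ 0 := by
      rw [sub_ne_zero]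
      exact fun e => by
        have := X_injective e
        omega
    refine mul_left_cancel₀ hij' ?_
    rw [hG w i j hij hw, ih, ← variableSeq_val, ← variableSeq_val, h]
    rfl

/-- The coefficient of `x^a` in `F w`, multiplied by `sgn(w) (-1)^{|a|}`. -/
def signedCoeff (F : Equiv.Perm (Fin n) → MvPolynomial (Fin n) ℤ) (w : Equiv.Perm (Fin n))
    (a : Fin n →₀ ℕ) : ℤ :=
  (Equiv.Perm.sign w : ℤ) * (-1) ^ a.degree * coeff a (F w)

theorem signedCoeff_ne_zero {F : Equiv.Perm (Fin n) → MvPolynomial (Fin n) ℤ}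
    {w : Equiv.Perm (Fin n)} {a : Fin n →₀ ℕ} : signedCoeff F w a ≠ 0 ↔ a ∈ (F w).support := by
  simp [signedCoeff, mem_support_iff]

theorem signedCoeff_step (b : ℤ) (F : Equiv.Perm (Fin n) → MvPolynomial (Fin n) ℤ)
    {i j k : Fin n} (hij : (j : ℕ) = i + 1) (w : Equiv.Perm (Fin n)) (a : Fin n →₀ ℕ) :
    signedCoeff (heckeFactor (C (-b)) (X k) i F) w a =
      signedCoeff F w a + if w j < w i ∧ k ∈ a.support then
        signedCoeff F (w * Equiv.swap i j) (a - Finsupp.single k 1) +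
          b * signedCoeff F w (a - Finsupp.single k 1) else 0 := by
  have hne : i ≠ j := by omega
  have hdeg : k ∈ a.support → a.degree = (a - Finsupp.single k 1).degree + 1 := fun hk => by
    have hle : Finsupp.single k 1 ≤ a := by
      rw [Finsupp.single_le_iff]
      exact Nat.one_le_iff_ne_zero.2 (Finsupp.mem_support_iff.1 hk)
    conv_lhs => rw [← tsub_add_cancel_of_le hle]
    simp
  simp only [signedCoeff, LinearMap.add_apply, Module.End.one_apply,
    LinearMap.smul_apply, Pi.add_apply, Pi.smul_apply, smul_eq_mul, coeff_add, coeff_X_mul']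
  by_cases hw : w j < w i
  · by_cases hk : k ∈ a.support
    · simp only [descentOp_of_lt _ hij _ hw, hw, hk, if_true, true_and, coeff_add, coeff_C_mul,
        Equiv.Perm.sign_mul, Equiv.Perm.sign_swap hne, hdeg hk, pow_succ]
      push_cast
      ring
    · simp [hk]
  · simp [descentOp_of_not_lt _ hij _ hw, hw]

/-- The relation between a Schubert-type family `F` and a Grothendieck-type family `H` which is
propagated along the staircase product. -/
structure SupportDominated (F H : Equiv.Perm (Fin n) → MvPolynomial (Fin n) ℤ) : Prop where
  left_nonneg : ∀ w a, 0 ≤ signedCoeff F w a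
  right_nonneg : ∀ w a, 0 ≤ signedCoeff H w a
  subset : ∀ w, (F w).support ⊆ (H w).support
  exists_le : ∀ w, ∀ a ∈ (H w).support, ∃ a' ∈ (F w).support, a' ≤ a

theorem SupportDominated.step {F H : Equiv.Perm (Fin n) → MvPolynomial (Fin n) ℤ}
    (h : SupportDominated F H) {b : ℤ} (hb : 0 ≤ b) (k : Fin n) (i : ℕ) :
    SupportDominated (heckeFactor (C (-0)) (X k) i F) (heckeFactor (C (-b)) (X k) i H) := by
  by_cases hi : i + 1 < n
  swap
  · simpa [heckeFactor, descentOp_eq_zero _ hi] using h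
  obtain ⟨i, rfl⟩ : ∃ t : Fin n, (t : ℕ) = i := ⟨⟨i, by omega⟩, rfl⟩
  obtain ⟨j, hij⟩ : ∃ j : Fin n, (j : ℕ) = i + 1 := ⟨⟨i + 1, hi⟩, rfl⟩
  have hF := signedCoeff_step 0 F (k := k) hij
  have hH := signedCoeff_step b H (k := k) hij
  refine ⟨fun w a => ?_, fun w a => ?_, fun w a ha => ?_, fun w a ha => ?_⟩
  · rw [hF]
    have := h.left_nonneg
    split_ifs
    · simpa using add_nonneg (this w a) (this _ _)
    · simpa using this w a
  · rw [hH]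
    have := h.right_nonneg
    split_ifs
    · exact add_nonneg (this w a) (add_nonneg (this _ _) (mul_nonneg hb (this _ _)))
    · simpa using this w a
  · rw [← signedCoeff_ne_zero, hF] at ha
    rw [← signedCoeff_ne_zero, hH]
    have hsub : ∀ w a, signedCoeff F w a ≠ 0 → signedCoeff H w a ≠ 0 := fun w a h' =>
      signedCoeff_ne_zero.2 (h.subset w (signedCoeff_ne_zero.1 h'))
    have hn := h.right_nonneg
    have h0 := hn w a
    split_ifs at ha ⊢ with hc
    · have h1 := hn (w * Equiv.swap i j) (a - Finsupp.single k 1)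
      have h2 := mul_nonneg hb (hn w (a - Finsupp.single k 1))
      have h3 := hsub w a
      have h4 := hsub (w * Equiv.swap i j) (a - Finsupp.single k 1)
      omega
    · simpa using hsub w a (by simpa using ha)
  · rw [← signedCoeff_ne_zero, hH] at ha
    have hn := h.left_nonneg
    have base : ∀ a' ∈ (H w).support, a' ≤ a →
        ∃ c ∈ (heckeFactor (C (-0)) (X k) i F w).support, c ≤ a := fun a' ha' hle => by
      obtain ⟨c, hc, hca⟩ := h.exists_le w a' ha'
      refine ⟨c, ?_, hca.trans hle⟩
      rw [← signedCoeff_ne_zero, hF]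
      rw [← signedCoeff_ne_zero] at hc
      have h0 := hn w c
      have h1 := hn (w * Equiv.swap i j) (c - Finsupp.single k 1)
      split_ifs <;> omega
    by_cases h0 : signedCoeff H w a = 0
    · rw [h0, zero_add] at ha
      split_ifs at ha with hc
      · by_cases h1 : signedCoeff H (w * Equiv.swap i j) (a - Finsupp.single k 1) = 0
        · rw [h1, zero_add] at ha
          exact base _ (signedCoeff_ne_zero.1 (right_ne_zero_of_mul ha)) tsub_le_self
        · obtain ⟨c, hc', hca⟩ := h.exists_le _ _ (signedCoeff_ne_zero.1 h1)
          have hle : Finsupp.single k 1 ≤ a := by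
            rw [Finsupp.single_le_iff]
            exact Nat.one_le_iff_ne_zero.2 (Finsupp.mem_support_iff.1 hc.2)
          refine ⟨c + Finsupp.single k 1, ?_, (add_le_add_left hca _).trans
            (tsub_add_cancel_of_le hle).le⟩
          rw [← signedCoeff_ne_zero, hF, if_pos ⟨hc.1, by simp⟩, add_tsub_cancel_right]
          rw [← signedCoeff_ne_zero] at hc'
          have h2 := hn w (c + Finsupp.single k 1)
          have h3 := hn (w * Equiv.swap i j) c
          omega
      · exact absurd rfl ha
    · exact base a (signedCoeff_ne_zero.1 h0) le_rfl

theorem SupportDominated.map_ladder {F H : Equiv.Perm (Fin n) → MvPolynomial (Fin n) ℤ}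
    (h : SupportDominated F H) {b : ℤ} (hb : 0 ≤ b) (k : Fin n) (m : ℕ) :
    ∀ i, SupportDominated (ladder (descentOp n (C (-0))) (X k : MvPolynomial (Fin n) ℤ) i m F)
      (ladder (descentOp n (C (-b))) (X k : MvPolynomial (Fin n) ℤ) i m H) := by
  induction m with
  | zero => exact fun _ => h
  | succ m ih =>
    intro i
    simp only [ladder, Module.End.mul_apply]
    exact (ih (i + 1)).step hb k i

theorem SupportDominated.map_staircase {F H : Equiv.Perm (Fin n) → MvPolynomial (Fin n) ℤ}
    (h : SupportDominated F H) {b : ℤ} (hb : 0 ≤ b) (N k : ℕ) (hk : k ≤ n) :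
    SupportDominated (staircase (descentOp n (C (-0))) N (variableSeq n) k F)
      (staircase (descentOp n (C (-b))) N (variableSeq n) k H) := by
  induction k with
  | zero => exact h
  | succ k ih =>
    have := (ih (by omega)).map_ladder hb ⟨k, hk⟩ (N - k) k
    rw [← variableSeq_val] at this
    exact this

theorem supportDominated_single :
    SupportDominated (Pi.single (1 : Equiv.Perm (Fin n)) (1 : MvPolynomial (Fin n) ℤ))
      (Pi.single 1 1) := by
  have h : ∀ (w : Equiv.Perm (Fin n)) a, 0 ≤ signedCoeff
      (Pi.single (1 : Equiv.Perm (Fin n)) (1 : MvPolynomial (Fin n) ℤ)) w a := fun w a => by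
    by_cases hw : w = 1
    · subst hw
      by_cases ha : a = 0
      · subst ha
        simp [signedCoeff]
      · simp [signedCoeff, coeff_one, Ne.symm ha]
    · simp [signedCoeff, hw]
  exact ⟨h, h, fun _ => subset_rfl, fun _ a ha => ⟨a, ha, le_rfl⟩⟩

end Supports

/-- Let `w ∈ S_n` (`n ≥ 1`) with `𝔖_w` multiplicity-free.  Then for every `b ∈ ℕ^n`,
some `a ∈ supp 𝔖_w` satisfies `a ≤ b` componentwise if and only if some
`a ∈ supp 𝔊_w` does. -/
theorem exists_le_support_schubert_iff_grothendieck {n : ℕ} (hn : 1 ≤ n)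
    (S G : Equiv.Perm (Fin n) → MvPolynomial (Fin n) ℤ)
    (hS : IsSchubertFamily S) (hG : IsGrothendieckFamily G)
    (w : Equiv.Perm (Fin n))
    (hmf : ∀ m : Fin n →₀ ℕ, (S w).coeff m = 0 ∨ (S w).coeff m = 1) :
    ∀ b : Fin n →₀ ℕ,
      (∃ a ∈ (S w).support, a ≤ b) ↔ (∃ a ∈ (G w).support, a ≤ b) := by
  have hS' : ∀ v, S v = heckeCoeff n (C (-0)) (variableSeq n) v :=
    eq_heckeCoeff hS.1 fun v i j hij hv => by simpa using hS.2 v i j hij hv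
  have hG' : ∀ v, G v = heckeCoeff n (C (-1)) (variableSeq n) v :=
    eq_heckeCoeff hG.1 fun v i j hij hv => by
      simpa [sub_eq_add_neg] using hG.2 v i j hij hv
  have hdom := supportDominated_single.map_staircase (n := n) zero_le_one (n - 1) n le_rfl
  intro b
  rw [hS', hG']
  constructor
  · rintro ⟨a, ha, hab⟩
    exact ⟨a, hdom.subset w ha, hab⟩
  · rintro ⟨a, ha, hab⟩
    obtain ⟨c, hc, hca⟩ := hdom.exists_le w a ha
    exact ⟨c, hc, hca.trans hab⟩
end
end

section
/- Let n ≥ 1 and let w ∈ S_n. Then the Schubert polynomial 𝔖_w is homogeneous of degree ℓ(w) (the Coxeter length of w), and every monomial appearing in 𝔊_w − 𝔖_w has total degree strictly greater than ℓ(w); equivalently, the homogeneous component of 𝔊_w of degree ℓ(w) equals 𝔖_w and all homogeneous components of 𝔊_w of degree less than ℓ(w) vanish. -/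
open scoped Classical
open MvPolynomial

noncomputable section

/-- The Coxeter length of `w`: the number of inversions, i.e. pairs `i < j` with
`w i > w j`. -/
def coxeterLength {n : ℕ} (w : Equiv.Perm (Fin n)) : ℕ :=
  (Finset.univ.filter (fun p : Fin n × Fin n => p.1 < p.2 ∧ w p.2 < w p.1)).card

section GradedPieces

variable {σ R : Type*} [CommRing R]

theorem MvPolynomial.homogeneousComponent_add_mul_of_isHomogeneous {a : MvPolynomial σ R} {m : ℕ}
    (ha : a.IsHomogeneous m) (k : ℕ) (p : MvPolynomial σ R) :
    homogeneousComponent (m + k) (a * p) = a * homogeneousComponent k p := by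
  have hcomp (l : ℕ) : homogeneousComponent (m + k) (a * homogeneousComponent l p) =
      if k = l then a * homogeneousComponent l p else 0 := by
    rw [homogeneousComponent_of_mem (ha.mul (homogeneousComponent_isHomogeneous l p))]
    simp
  conv_lhs => rw [← sum_homogeneousComponent p]
  rw [Finset.mul_sum, map_sum]
  simp only [hcomp, Finset.sum_ite_eq, Finset.mem_range]
  split_ifs with hk
  · rfl
  · rw [homogeneousComponent_eq_zero _ _ (by omega), mul_zero]

theorem MvPolynomial.IsHomogeneous.of_mul_left [IsDomain R] {a p : MvPolynomial σ R} {m k : ℕ}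
    (ha : a.IsHomogeneous m) (ha₀ : a ≠ 0) (h : (a * p).IsHomogeneous (m + k)) :
    p.IsHomogeneous k := by
  have hp : homogeneousComponent k p = p := mul_left_cancel₀ ha₀ <| by
    rw [← homogeneousComponent_add_mul_of_isHomogeneous ha, homogeneousComponent_eq_self h]
  exact hp ▸ homogeneousComponent_isHomogeneous k p

end GradedPieces

section Length

variable {n : ℕ}

theorem coxeterLength_revPerm :
    coxeterLength (Fin.revPerm : Equiv.Perm (Fin n)) = ∑ i : Fin n, (Fin.rev i : ℕ) := by
  have h : (Finset.univ.filter fun p : Fin n × Fin n =>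
      p.1 < p.2 ∧ Fin.revPerm p.2 < Fin.revPerm p.1) =
      (Finset.univ : Finset (Fin n)).biUnion fun i => (Finset.Ioi i).map
        ⟨fun j => (i, j), Prod.mk_right_injective i⟩ := by
    ext ⟨a, b⟩
    simp
  rw [coxeterLength, h, Finset.card_biUnion]
  · refine Finset.sum_congr rfl fun i _ => ?_
    rw [Finset.card_map, Fin.card_Ioi, Fin.val_rev]
    omega
  · intro a _ b _ hab
    rw [Function.onFun, Finset.disjoint_left]
    rintro ⟨x, y⟩ hx hy
    simp_all

theorem swap_lt_swap_of_lt {i j : Fin n} (hij : (j : ℕ) = i + 1) {a b : Fin n} (hab : a < b)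
    (hne : ¬(a = i ∧ b = j)) : Equiv.swap i j a < Equiv.swap i j b := by
  simp only [Equiv.swap_apply_def]
  split_ifs <;> simp only [Fin.lt_def, Fin.ext_iff] at * <;> omega

theorem coxeterLength_mul_swap {i j : Fin n} (hij : (j : ℕ) = i + 1) {w : Equiv.Perm (Fin n)}
    (hw : w i < w j) : coxeterLength (w * Equiv.swap i j) = coxeterLength w + 1 := by
  have hlt : i < j := by rw [Fin.lt_def]; omega
  set e : Fin n × Fin n ≃ Fin n × Fin n := (Equiv.swap i j).prodCongr (Equiv.swap i j) with he
  have h : (Finset.univ.filter fun p : Fin n × Fin n => p.1 < p.2 ∧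
        (w * Equiv.swap i j) p.2 < (w * Equiv.swap i j) p.1) =
      insert (i, j) ((Finset.univ.filter fun p : Fin n × Fin n =>
        p.1 < p.2 ∧ w p.2 < w p.1).map e.toEmbedding) := by
    ext ⟨a, b⟩
    have hmem : (a, b) ∈ (Finset.univ.filter fun p : Fin n × Fin n =>
        p.1 < p.2 ∧ w p.2 < w p.1).map e.toEmbedding ↔
        Equiv.swap i j a < Equiv.swap i j b ∧
          w (Equiv.swap i j b) < w (Equiv.swap i j a) := by
      rw [Finset.mem_map_equiv]
      simp [he]
    rw [Finset.mem_insert, hmem, Finset.mem_filter]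
    simp only [Finset.mem_univ, true_and, Equiv.Perm.mul_apply, Prod.mk.injEq]
    by_cases hab : a = i ∧ b = j
    · obtain ⟨rfl, rfl⟩ := hab
      simp [hlt, hw]
    · simp only [hab, false_or]
      refine and_congr_left fun hinv => ⟨fun h => swap_lt_swap_of_lt hij h hab, fun h => ?_⟩
      have hne : ¬(Equiv.swap i j a = i ∧ Equiv.swap i j b = j) := by
        rintro ⟨h₁, h₂⟩
        rw [h₁, h₂] at hinv
        exact hinv.not_gt hw
      simpa using swap_lt_swap_of_lt hij h hne
  rw [coxeterLength, h, Finset.card_insert_of_notMem, Finset.card_map, coxeterLength]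
  rw [Finset.mem_map_equiv]
  simp [he, hlt.not_gt]

theorem Equiv.Perm.eq_revPerm_of_strictAnti {w : Equiv.Perm (Fin n)} (hw : StrictAnti w) :
    w = Fin.revPerm := by
  have hmono : StrictMono (Fin.rev ∘ w) := Fin.rev_strictAnti.comp hw
  have hid : Fin.rev ∘ w = id := by
    refine hmono.range_inj strictMono_id |>.1 ?_
    rw [(Fin.rev_surjective.comp w.surjective).range_eq, Set.range_id]
  ext x
  have := congrFun hid x
  rw [Function.comp_apply, id, Fin.rev_eq_iff] at this
  simp [this]

theorem exists_ascent_of_ne_revPerm {w : Equiv.Perm (Fin n)} (hw : w ≠ Fin.revPerm) :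
    ∃ i j : Fin n, (j : ℕ) = i + 1 ∧ w i < w j := by
  contrapose! hw
  refine Equiv.Perm.eq_revPerm_of_strictAnti ((strictAnti_iff_forall_covBy _).2 fun i j hij => ?_)
  refine lt_of_le_of_ne (hw i j ?_) (w.injective.ne hij.lt.ne')
  have := Fin.covBy_iff.1 hij
  rw [Nat.covBy_iff_add_one_eq] at this
  exact this.symm

/-- Downward induction in weak Bruhat order, from the longest element. -/
theorem Equiv.Perm.weakOrder_induction {P : Equiv.Perm (Fin n) → Prop} (top : P Fin.revPerm)
    (step : ∀ (w : Equiv.Perm (Fin n)) (i j : Fin n), (j : ℕ) = i + 1 → w i < w j →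
      P (w * Equiv.swap i j) → P w) (w : Equiv.Perm (Fin n)) : P w := by
  have hbound (u : Equiv.Perm (Fin n)) : coxeterLength u ≤ Fintype.card (Fin n × Fin n) :=
    Finset.card_le_univ _
  induction hk : Fintype.card (Fin n × Fin n) - coxeterLength w using Nat.strong_induction_on
    generalizing w with
  | _ k ih =>
    by_cases hw : w = Fin.revPerm
    · exact hw ▸ top
    obtain ⟨i, j, hij, hlt⟩ := exists_ascent_of_ne_revPerm hw
    refine step w i j hij hlt (ih _ ?_ _ rfl)
    have := coxeterLength_mul_swap hij hlt
    have := hbound (w * Equiv.swap i j)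
    omega

end Length

theorem MvPolynomial.isHomogeneous_X_sub_X {σ : Type*} (i j : σ) :
    (X i - X j : MvPolynomial σ ℤ).IsHomogeneous 1 :=
  (isHomogeneous_X ℤ i).sub (isHomogeneous_X ℤ j)

theorem IsSchubertFamily.isHomogeneous {n : ℕ} {S : Equiv.Perm (Fin n) → MvPolynomial (Fin n) ℤ}
    (hS : IsSchubertFamily S) (w : Equiv.Perm (Fin n)) :
    (S w).IsHomogeneous (coxeterLength w) := by
  induction w using Equiv.Perm.weakOrder_induction with
  | top =>
    rw [hS.1, coxeterLength_revPerm]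
    exact IsHomogeneous.prod _ _ _ fun i _ => isHomogeneous_X_pow i _
  | step w i j hij hlt ih =>
    have hne : i ≠ j := fun h => by simp [h] at hlt
    have hrec := hS.2 (w * Equiv.swap i j) i j hij (by simpa using hlt)
    rw [mul_assoc, Equiv.swap_mul_self, mul_one] at hrec
    rw [coxeterLength_mul_swap hij hlt, add_comm] at ih
    refine (isHomogeneous_X_sub_X i j).of_mul_left
      (sub_ne_zero.2 fun h => hne (X_injective h)) ?_
    rw [hrec]
    exact ih.sub ih.rename_isHomogeneous

theorem homogeneousComponent_grothendieck_sub_schubert {n : ℕ}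
    {S G : Equiv.Perm (Fin n) → MvPolynomial (Fin n) ℤ}
    (hS : IsSchubertFamily S) (hG : IsGrothendieckFamily G) (w : Equiv.Perm (Fin n)) :
    ∀ k ≤ coxeterLength w, homogeneousComponent k (G w - S w) = 0 := by
  induction w using Equiv.Perm.weakOrder_induction with
  | top => simp [hS.1, hG.1]
  | step w i j hij hlt ih =>
    intro k hk
    set u := w * Equiv.swap i j with hu
    have hne : i ≠ j := fun h => by simp [h] at hlt
    have hrecS := hS.2 u i j hij (by simpa [hu] using hlt)
    have hrecG := hG.2 u i j hij (by simpa [hu] using hlt)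
    have huw : u * Equiv.swap i j = w := by
      rw [hu, mul_assoc, Equiv.swap_mul_self, mul_one]
    rw [huw] at hrecS hrecG
    have hlen : coxeterLength u = coxeterLength w + 1 := coxeterLength_mul_swap hij hlt
    have hGu : homogeneousComponent k (G u) = 0 := by
      have h := ih k (by omega)
      rwa [map_sub, homogeneousComponent_of_mem (hS.isHomogeneous u), if_neg (by omega),
        sub_zero] at h
    have hrec : (X i - X j) * (G w - S w) =
        (G u - S u) - rename (Equiv.swap i j) (G u - S u) -
          (X j * G u - rename (Equiv.swap i j) (X j * G u)) := by
      rw [mul_sub, hrecS, hrecG]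
      simp only [map_sub, map_mul, map_one]
      ring
    have hD := ih (1 + k) (by omega)
    have hX : homogeneousComponent (1 + k) (X j * G u) = 0 := by
      rw [homogeneousComponent_add_mul_of_isHomogeneous (isHomogeneous_X ℤ j), hGu, mul_zero]
    refine (mul_eq_zero.1 ?_).resolve_left
      (sub_ne_zero.2 fun h => hne (X_injective (R := ℤ) h))
    rw [← homogeneousComponent_add_mul_of_isHomogeneous (isHomogeneous_X_sub_X i j), hrec,
      map_sub _ (_ - rename _ _), map_sub _ (G u - S u), map_sub _ (X j * G u),
      ← rename_homogeneousComponent, ← rename_homogeneousComponent, hD, hX]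
    simp

/-- For `w ∈ S_n` (`n ≥ 1`), the Schubert polynomial `𝔖_w` is homogeneous of degree
`ℓ(w)`, and every monomial of `𝔊_w - 𝔖_w` has total degree strictly greater than
`ℓ(w)`; in particular the degree-`ℓ(w)` component of `𝔊_w` is `𝔖_w` and all
lower-degree components vanish. -/
theorem schubert_isHomogeneous_and_grothendieck_higher {n : ℕ} (hn : 1 ≤ n)
    (S G : Equiv.Perm (Fin n) → MvPolynomial (Fin n) ℤ)
    (hS : IsSchubertFamily S) (hG : IsGrothendieckFamily G)
    (w : Equiv.Perm (Fin n)) :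
    (S w).IsHomogeneous (coxeterLength w) ∧
    ∀ m ∈ (G w - S w).support, coxeterLength w < m.sum (fun _ e => e) := by
  refine ⟨hS.isHomogeneous w, fun m hm => ?_⟩
  by_contra! hle
  have h := congrArg (coeff m) (homogeneousComponent_grothendieck_sub_schubert hS hG w _ hle)
  rw [coeff_homogeneousComponent, if_pos (show m.degree = m.sum fun _ e => e from rfl), coeff_zero] at h
  exact mem_support_iff.1 hm h
end
end

section
/- Let w ∈ S_6 be the permutation with one-line notation 143562, let P' = {b ∈ ℕ^6 : there exists a ∈ supp(𝔖_w) with a ≤ b componentwise}, ordered componentwise, and let μ : P' → ℤ be the unique function satisfying ∑_{a ∈ P', a ≤ b} μ(a) = 1 for every b ∈ P'. Then μ(b) = 1 for each of the nine elements b of supp(𝔖_w); μ((2,1,1,1,1,0)) = −4; μ((1,2,1,1,1,0)) = −4; μ((2,2,1,1,0,0)) = μ((2,2,1,0,1,0)) = μ((2,2,0,1,1,0)) = −1; μ((2,2,1,1,1,0)) = 3; and μ(b) = 0 for all other b ∈ P'. -/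
open scoped Classical
open MvPolynomial

noncomputable section

/-- The exponent vector `(a 0, …, a 5) ∈ ℕ^6` as a finitely supported function. -/
def vec (a : Fin 6 → ℕ) : Fin 6 →₀ ℕ := Finsupp.equivFunOnFinite.symm a

theorem IsSchubertFamily.divided_difference {n : ℕ}
    {S : Equiv.Perm (Fin n) → MvPolynomial (Fin n) ℤ} (hS : IsSchubertFamily S)
    {w : Equiv.Perm (Fin n)} {p : MvPolynomial (Fin n) ℤ} (hp : S w = p) (i j : Fin n)
    (q : MvPolynomial (Fin n) ℤ) (hij : (j : ℕ) = i + 1) (hw : w j < w i)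
    (hq : (X i - X j) * q = p - rename (Equiv.swap i j) p) :
    S (w * Equiv.swap i j) = q := by
  have hne : (X i - X j : MvPolynomial (Fin n) ℤ) ≠ 0 := by
    rw [sub_ne_zero]
    intro h
    have := X_injective h
    omega
  refine mul_left_cancel₀ hne ?_
  rw [hS.2 w i j hij hw, hq, hp]

theorem schubert_143562 {S : Equiv.Perm (Fin 6) → MvPolynomial (Fin 6) ℤ}
    (hS : IsSchubertFamily S) {w : Equiv.Perm (Fin 6)}
    (hw : w 0 = 0 ∧ w 1 = 3 ∧ w 2 = 2 ∧ w 3 = 4 ∧ w 4 = 5 ∧ w 5 = 1) :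
    S w = X 0 ^ 2 * X 1 * X 2 * X 3 + X 0 ^ 2 * X 1 * X 2 * X 4 + X 0 ^ 2 * X 1 * X 3 * X 4
      + X 0 ^ 2 * X 2 * X 3 * X 4 + X 0 * X 1 ^ 2 * X 2 * X 3 + X 0 * X 1 ^ 2 * X 2 * X 4
      + X 0 * X 1 ^ 2 * X 3 * X 4 + X 0 * X 1 * X 2 * X 3 * X 4
      + X 1 ^ 2 * X 2 * X 3 * X 4 := by
  have h0 : S Fin.revPerm = X 0 ^ 5 * X 1 ^ 4 * X 2 ^ 3 * X 3 ^ 2 * X 4 := by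
    rw [hS.1]
    simp [Fin.prod_univ_six, Fin.val_rev]
  have h1 := hS.divided_difference h0 4 5
    (X 0 ^ 5 * X 1 ^ 4 * X 2 ^ 3 * X 3 ^ 2) (by decide) (by decide)
    (by simp [Equiv.swap_apply_def]; ring)
  have h2 := hS.divided_difference h1 0 1
    (X 0 ^ 4 * X 1 ^ 4 * X 2 ^ 3 * X 3 ^ 2) (by decide) (by decide)
    (by simp [Equiv.swap_apply_def]; ring)
  have h3 := hS.divided_difference h2 1 2
    (X 0 ^ 4 * X 1 ^ 3 * X 2 ^ 3 * X 3 ^ 2) (by decide) (by decide)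
    (by simp [Equiv.swap_apply_def]; ring)
  have h4 := hS.divided_difference h3 2 3
    (X 0 ^ 4 * X 1 ^ 3 * X 2 ^ 2 * X 3 ^ 2) (by decide) (by decide)
    (by simp [Equiv.swap_apply_def]; ring)
  have h5 := hS.divided_difference h4 0 1
    (X 0 ^ 3 * X 1 ^ 3 * X 2 ^ 2 * X 3 ^ 2) (by decide) (by decide)
    (by simp [Equiv.swap_apply_def]; ring)
  have h6 := hS.divided_difference h5 1 2
    (X 0 ^ 3 * X 1 ^ 2 * X 2 ^ 2 * X 3 ^ 2) (by decide) (by decide)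
    (by simp [Equiv.swap_apply_def]; ring)
  have h7 := hS.divided_difference h6 3 4
    (X 0 ^ 3 * X 1 ^ 2 * X 2 ^ 2 * (X 3 + X 4)) (by decide) (by decide)
    (by simp [Equiv.swap_apply_def]; ring)
  have h8 := hS.divided_difference h7 2 3
    (X 0 ^ 3 * X 1 ^ 2 * (X 2 * X 3 + X 2 * X 4 + X 3 * X 4)) (by decide) (by decide)
    (by simp [Equiv.swap_apply_def]; ring)
  have h9 := hS.divided_difference h8 1 2
    (X 0 ^ 3 * (X 1 * X 2 * X 3 + X 1 * X 2 * X 4 + X 1 * X 3 * X 4 + X 2 * X 3 * X 4))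
    (by decide) (by decide)
    (by simp [Equiv.swap_apply_def]; ring)
  have h10 := hS.divided_difference h9 0 1
    (X 0 ^ 2 * X 1 * X 2 * X 3 + X 0 ^ 2 * X 1 * X 2 * X 4
    + X 0 ^ 2 * X 1 * X 3 * X 4 + X 0 ^ 2 * X 2 * X 3 * X 4 + X 0 * X 1 ^ 2 * X 2 * X 3
    + X 0 * X 1 ^ 2 * X 2 * X 4 + X 0 * X 1 ^ 2 * X 3 * X 4 + X 0 * X 1 * X 2 * X 3 * X 4
    + X 1 ^ 2 * X 2 * X 3 * X 4) (by decide) (by decide)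
    (by simp [Equiv.swap_apply_def]; ring)
  have hw' (i : Fin 6) : w i = (![0, 3, 2, 4, 5, 1] : Fin 6 → Fin 6) i := by
    obtain ⟨w0, w1, w2, w3, w4, w5⟩ := hw
    fin_cases i <;> assumption
  rw [← h10]
  refine congrArg S (Equiv.ext fun i => (hw' i).trans ?_)
  clear hw hw' h0 h1 h2 h3 h4 h5 h6 h7 h8 h9 h10
  revert i
  decide

theorem vec_injective : Function.Injective vec :=
  Finsupp.equivFunOnFinite.symm.injective

theorem vec_le_iff (a : Fin 6 → ℕ) (b : Fin 6 →₀ ℕ) : vec a ≤ b ↔ ∀ i, a i ≤ b i :=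
  Iff.rfl

theorem monomial_vec (a : Fin 6 → ℕ) :
    monomial (vec a) (1 : ℤ) = ∏ i, X i ^ a i := by
  rw [monomial_eq, Finsupp.prod_fintype _ _ (by simp)]
  simp [vec]

/-- The elements of `P'` at which `μ` does not vanish; the first nine are the exponents of the
Schubert polynomial of `143562`. -/
def mobiusPoint : Fin 15 → Fin 6 → ℕ :=
  ![![2,0,1,1,1,0], ![1,1,1,1,1,0], ![2,1,1,1,0,0], ![1,2,1,1,0,0], ![2,1,1,0,1,0],
    ![1,2,1,0,1,0], ![2,1,0,1,1,0], ![1,2,0,1,1,0], ![0,2,1,1,1,0],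
    ![2,1,1,1,1,0], ![1,2,1,1,1,0], ![2,2,1,1,0,0], ![2,2,1,0,1,0], ![2,2,0,1,1,0],
    ![2,2,1,1,1,0]]

/-- The nonzero values of `μ`. -/
def mobiusValue : Fin 15 → ℤ :=
  ![1, 1, 1, 1, 1, 1, 1, 1, 1, -4, -4, -1, -1, -1, 3]

theorem mobiusPoint_injective : Function.Injective mobiusPoint := by
  have h : ∀ p q, (∀ i, mobiusPoint p i = mobiusPoint q i) → p = q := by decide
  exact fun p q hpq => h p q (congrFun hpq)

theorem mem_support_schubert_143562 {S : Equiv.Perm (Fin 6) → MvPolynomial (Fin 6) ℤ}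
    (hS : IsSchubertFamily S) {w : Equiv.Perm (Fin 6)}
    (hw : w 0 = 0 ∧ w 1 = 3 ∧ w 2 = 2 ∧ w 3 = 4 ∧ w 4 = 5 ∧ w 5 = 1) (b : Fin 6 →₀ ℕ) :
    b ∈ (S w).support ↔ ∃ p : Fin 9, vec (mobiusPoint (p.castLE (by decide))) = b := by
  have h : S w = ∑ p : Fin 9, monomial (vec (mobiusPoint (p.castLE (by decide)))) (1 : ℤ) := by
    rw [schubert_143562 hS hw]
    simp only [monomial_vec, Fin.prod_univ_six, Fin.sum_univ_succ, Fin.sum_univ_zero]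
    simp [mobiusPoint, Fin.castLE]
    ring
  rw [h, mem_support_iff, coeff_sum]
  simp only [coeff_monomial]
  rw [Finset.sum_boole, Nat.cast_ne_zero, Finset.card_ne_zero]
  simp [Finset.Nonempty]

/-- A function on an order with finite down-sets is determined on a subset `P` by its sums over
the principal down-sets of `P`. -/
theorem eq_of_sum_Iic_filter_eq {α : Type*} [PartialOrder α] [LocallyFiniteOrderBot α]
    [WellFoundedLT α] {P : α → Prop} [DecidablePred P] {f g : α → ℤ}
    (h : ∀ b, P b → ∑ a ∈ (Finset.Iic b).filter P, f a = ∑ a ∈ (Finset.Iic b).filter P, g a)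
    (b : α) (hb : P b) : f b = g b := by
  induction b using WellFoundedLT.induction with
  | ind b ih =>
    have hsplit (k : α → ℤ) : ∑ a ∈ (Finset.Iic b).filter P, k a =
        k b + ∑ a ∈ (Finset.Iio b).filter P, k a := by
      rw [← Finset.Iio_insert, Finset.filter_insert, if_pos hb, Finset.sum_insert (by simp)]
    have hlt : ∑ a ∈ (Finset.Iio b).filter P, f a = ∑ a ∈ (Finset.Iio b).filter P, g a := by
      refine Finset.sum_congr rfl fun a ha => ?_
      rw [Finset.mem_filter, Finset.mem_Iio] at ha
      exact ih a ha.1 ha.2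
    have := h b hb
    rw [hsplit, hsplit, hlt] at this
    exact add_right_cancel this

/-- The candidate for `μ`, extended by zero outside `P'`. -/
def mobiusFun (b : Fin 6 →₀ ℕ) : ℤ :=
  ∑ p, if vec (mobiusPoint p) = b then mobiusValue p else 0

theorem mobiusFun_vec_mobiusPoint (q : Fin 15) :
    mobiusFun (vec (mobiusPoint q)) = mobiusValue q := by
  simp [mobiusFun, vec_injective.eq_iff, mobiusPoint_injective.eq_iff]

theorem exists_mobiusPoint_le (q : Fin 15) :
    ∃ p : Fin 9, ∀ i, mobiusPoint (p.castLE (by decide)) i ≤ mobiusPoint q i := by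
  revert q
  decide

theorem mobiusPoint_le_top (p : Fin 15) (i : Fin 6) : mobiusPoint p i ≤ mobiusPoint 14 i := by
  revert p i
  decide

theorem sum_mobiusValue_of_le_top (a : Fin 3) (b : Fin 3) (c d e : Fin 2)
    (h : ∃ p : Fin 9, ∀ i,
      mobiusPoint (p.castLE (by decide)) i ≤ (![a, b, c, d, e, 0] : Fin 6 → ℕ) i) :
    (∑ p, if ∀ i, mobiusPoint p i ≤ (![a, b, c, d, e, 0] : Fin 6 → ℕ) i
      then mobiusValue p else 0) = 1 := by
  revert a b c d e
  decide

theorem sum_mobiusValue (b : Fin 6 → ℕ)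
    (h : ∃ p : Fin 9, ∀ i, mobiusPoint (p.castLE (by decide)) i ≤ b i) :
    (∑ p, if ∀ i, mobiusPoint p i ≤ b i then mobiusValue p else 0) = 1 := by
  set c : Fin 6 → ℕ := ![(⟨min (b 0) 2, by omega⟩ : Fin 3), (⟨min (b 1) 2, by omega⟩ : Fin 3),
    (⟨min (b 2) 1, by omega⟩ : Fin 2), (⟨min (b 3) 1, by omega⟩ : Fin 2),
    (⟨min (b 4) 1, by omega⟩ : Fin 2), 0] with hc
  have hcap : c = fun i => min (b i) (mobiusPoint 14 i) := by
    ext i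
    fin_cases i <;> simp [hc, mobiusPoint]
  have hle (p : Fin 15) : (∀ i, mobiusPoint p i ≤ b i) ↔ ∀ i, mobiusPoint p i ≤ c i := by
    simp [hcap, mobiusPoint_le_top]
  simp only [hle] at h ⊢
  exact sum_mobiusValue_of_le_top _ _ _ _ _ h

theorem sum_mobiusFun {P : (Fin 6 →₀ ℕ) → Prop} [DecidablePred P]
    (hP : ∀ b, P b ↔ ∃ p : Fin 9, vec (mobiusPoint (p.castLE (by decide))) ≤ b)
    (b : Fin 6 →₀ ℕ) (hb : P b) : ∑ a ∈ (Finset.Iic b).filter P, mobiusFun a = 1 := by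
  have hpt (p : Fin 15) : P (vec (mobiusPoint p)) := (hP _).2 (exists_mobiusPoint_le p)
  simp only [mobiusFun]
  rw [Finset.sum_comm]
  simp only [Finset.sum_ite_eq, Finset.mem_filter, Finset.mem_Iic, hpt, and_true, vec_le_iff]
  convert sum_mobiusValue b ((hP b).1 hb)
/-- Let `w ∈ S_6` have one-line notation `143562`, let
`P' = {b ∈ ℕ^6 : ∃ a ∈ supp 𝔖_w, a ≤ b}` (componentwise order), and let `μ : P' → ℤ`
be the unique function with `∑_{a ∈ P', a ≤ b} μ a = 1` for all `b ∈ P'`.  Then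
`μ b = 1` for the nine `b ∈ supp 𝔖_w`; `μ (2,1,1,1,1,0) = μ (1,2,1,1,1,0) = -4`;
`μ (2,2,1,1,0,0) = μ (2,2,1,0,1,0) = μ (2,2,0,1,1,0) = -1`; `μ (2,2,1,1,1,0) = 3`;
and `μ b = 0` for all other `b ∈ P'`. -/
theorem mobius_143562 (S : Equiv.Perm (Fin 6) → MvPolynomial (Fin 6) ℤ)
    (hS : IsSchubertFamily S) (w : Equiv.Perm (Fin 6))
    (hw : w 0 = 0 ∧ w 1 = 3 ∧ w 2 = 2 ∧ w 3 = 4 ∧ w 4 = 5 ∧ w 5 = 1)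
    (μ : (Fin 6 →₀ ℕ) → ℤ)
    (hμ : ∀ b : Fin 6 →₀ ℕ, (∃ a ∈ (S w).support, a ≤ b) →
      ∑ a ∈ (Finset.Iic b).filter (fun a => ∃ c ∈ (S w).support, c ≤ a), μ a = 1) :
    (∀ b ∈ (S w).support, μ b = 1) ∧
    μ (vec ![2,1,1,1,1,0]) = -4 ∧
    μ (vec ![1,2,1,1,1,0]) = -4 ∧
    μ (vec ![2,2,1,1,0,0]) = -1 ∧
    μ (vec ![2,2,1,0,1,0]) = -1 ∧
    μ (vec ![2,2,0,1,1,0]) = -1 ∧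
    μ (vec ![2,2,1,1,1,0]) = 3 ∧
    (∀ b : Fin 6 →₀ ℕ, (∃ a ∈ (S w).support, a ≤ b) →
      b ∉ (S w).support →
      b ∉ ({vec ![2,1,1,1,1,0], vec ![1,2,1,1,1,0], vec ![2,2,1,1,0,0],
            vec ![2,2,1,0,1,0], vec ![2,2,0,1,1,0], vec ![2,2,1,1,1,0]} :
            Finset (Fin 6 →₀ ℕ)) →
      μ b = 0) := by
  have hsupp := mem_support_schubert_143562 hS hw
  have hP (b : Fin 6 →₀ ℕ) : (∃ a ∈ (S w).support, a ≤ b) ↔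
      ∃ p : Fin 9, vec (mobiusPoint (p.castLE (by decide))) ≤ b := by
    simp only [hsupp]
    constructor
    · rintro ⟨_, ⟨p, rfl⟩, h⟩
      exact ⟨p, h⟩
    · rintro ⟨p, h⟩
      exact ⟨_, ⟨p, rfl⟩, h⟩
  have hμ_eq (b : Fin 6 →₀ ℕ) (hb : ∃ a ∈ (S w).support, a ≤ b) : μ b = mobiusFun b :=
    eq_of_sum_Iic_filter_eq (P := fun b => ∃ a ∈ (S w).support, a ≤ b)
      (fun b hb => (hμ b hb).trans (sum_mobiusFun hP b hb).symm) b hb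
  have hval (q : Fin 15) : μ (vec (mobiusPoint q)) = mobiusValue q := by
    rw [hμ_eq _ ((hP _).2 (exists_mobiusPoint_le q)), mobiusFun_vec_mobiusPoint]
  refine ⟨?_, hval 9, hval 10, hval 11, hval 12, hval 13, hval 14, ?_⟩
  · intro b hb
    obtain ⟨p, rfl⟩ := (hsupp b).1 hb
    rw [hval]
    clear hb
    revert p
    decide
  · intro b hb hb_supp hb_exc
    rw [hμ_eq b hb]
    refine Finset.sum_eq_zero fun p _ => if_neg ?_
    rintro rfl
    by_cases hp : (p : ℕ) < 9
    · exact hb_supp ((hsupp _).2 ⟨⟨p, hp⟩, rfl⟩)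
    · refine hb_exc ?_
      clear hb hb_supp hb_exc
      fin_cases p <;> simp_all [mobiusPoint]
end
end
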